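/- arXiv:2101.10882 — 6 statements merged into one kernel-verified Lean document; each statement's English description precedes it below -/
import Mathlib

section
/- Let q be a positive integer and let μ be a joint probability mass function on (Fin q) × (Fin q) with marginals p(α) = ∑_β μ(α,β) and p'(β) = ∑_α μ(α,β). Define the q×q matrices T_{a|b} = (I − p·𝟙ᵀ)·Ψ_{a|b} and T_{b|a} = (I − p'·𝟙ᵀ)·Ψ_{b|a}, and let D_p† be the diagonal matrix whose (α,α) entry equals 1/p(α) if p(α) ≠ 0 and 0 otherwise (similarly D_{p'}†). Then D_p† · T_{a|b} = (T_{b|a})ᵀ · D_{p'}†. -/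
/-- Entries of `(I - v 𝟙ᵀ) A`. -/
theorem one_sub_col_mul_apply {n : Type*} [Fintype n] [DecidableEq n] (v : n → ℝ)
    (A : Matrix n n ℝ) (i j : n) :
    ((1 - Matrix.of fun a _ => v a : Matrix n n ℝ) * A) i j = A i j - v i * ∑ k, A k j := by
  rw [Matrix.sub_mul, Matrix.one_mul, Matrix.sub_apply, Matrix.mul_apply, Finset.mul_sum]
  rfl

/-- Part (2) of the paper's Claim on BP partial-derivative (transition) matrices:
`D_p† · T_{a|b} = (T_{b|a})ᵀ · D_{p'}†`. -/
theorem stmt0 (q : ℕ) (hq : 0 < q) (μ : Fin q → Fin q → ℝ)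
    (hμ0 : ∀ a b, 0 ≤ μ a b) (hμ1 : ∑ a, ∑ b, μ a b = 1)
    (p p' : Fin q → ℝ)
    (hp : ∀ a, p a = ∑ b, μ a b) (hp' : ∀ b, p' b = ∑ a, μ a b)
    (Ψab Ψba Tab Tba Dp Dp' : Matrix (Fin q) (Fin q) ℝ)
    (hΨab : ∀ a b, Ψab a b = μ a b / p' b)
    (hΨba : ∀ b a, Ψba b a = μ a b / p a)
    (hTab : Tab = (1 - Matrix.of fun a _ => p a) * Ψab)
    (hTba : Tba = (1 - Matrix.of fun b _ => p' b) * Ψba)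
    (hDp : Dp = Matrix.diagonal fun a => if p a ≠ 0 then (p a)⁻¹ else 0)
    (hDp' : Dp' = Matrix.diagonal fun b => if p' b ≠ 0 then (p' b)⁻¹ else 0) :
    Dp * Tab = Tba.transpose * Dp' := by
  subst hTab hTba hDp hDp'
  ext a b
  rw [Matrix.diagonal_mul, Matrix.mul_diagonal, Matrix.transpose_apply,
    one_sub_col_mul_apply, one_sub_col_mul_apply]
  simp only [hΨab, hΨba, ← Finset.sum_div, ← hp, ← hp']
  by_cases ha : p a = 0 <;> by_cases hb : p' b = 0 <;> simp [ha, hb]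
  field_simp
end

section
/- Let q be a positive integer and let μ be a joint probability mass function on (Fin q) × (Fin q) with marginals p(α) = ∑_β μ(α,β) and p'(β) = ∑_α μ(α,β), and assume every entry of p and of p' is strictly positive. Then (D_p − p·pᵀ) · (I − (1/q)·𝟙·𝟙ᵀ) · (Ψ_{b|a})ᵀ · D_{p'}^{-1} = (I − p·𝟙ᵀ) · Ψ_{a|b}. -/
/-- The paper's Appendix C identity: the composition of the two BP partial-derivative
matrices at the uninformative fixed point (full support) equals the centered transition
matrix `(I − p𝟙ᵀ)Ψ_{a|b}`. -/
theorem stmt1 (q : ℕ) (hq : 0 < q) (μ : Fin q → Fin q → ℝ)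
    (hμ0 : ∀ a b, 0 ≤ μ a b) (hμ1 : ∑ a, ∑ b, μ a b = 1)
    (p p' : Fin q → ℝ)
    (hp : ∀ a, p a = ∑ b, μ a b) (hp' : ∀ b, p' b = ∑ a, μ a b)
    (hppos : ∀ a, 0 < p a) (hp'pos : ∀ b, 0 < p' b)
    (Ψab Ψba : Matrix (Fin q) (Fin q) ℝ)
    (hΨab : ∀ a b, Ψab a b = μ a b / p' b)
    (hΨba : ∀ b a, Ψba b a = μ a b / p a) :
    (Matrix.diagonal p - Matrix.of fun a b => p a * p b) *
        (1 - (q : ℝ)⁻¹ • Matrix.of fun _ _ => (1 : ℝ)) *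
        Ψba.transpose * Matrix.diagonal (fun b => (p' b)⁻¹) =
      (1 - Matrix.of fun a _ => p a) * Ψab := by
  have hp1 : ∑ a, p a = 1 := by simpa [hp] using hμ1
  have hker : (Matrix.diagonal p - Matrix.of fun a b => p a * p b) *
      (Matrix.of fun _ _ => (1 : ℝ)) = 0 := by
    ext a b
    simp [Matrix.mul_apply, Matrix.diagonal_apply, ← Finset.mul_sum, hp1]
  have hpΨ : ∀ a b, p a * Ψba b a = μ a b := fun a b => by
    rw [hΨba, mul_div_cancel₀ _ (hppos a).ne']
  rw [Matrix.mul_sub, Matrix.mul_one, Matrix.mul_smul, hker, smul_zero, sub_zero]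
  ext a b
  rw [Matrix.mul_diagonal, Matrix.sub_mul, Matrix.sub_mul, Matrix.sub_apply, Matrix.sub_apply,
    Matrix.diagonal_mul, Matrix.one_mul]
  simp only [Matrix.mul_apply, Matrix.of_apply, Matrix.transpose_apply, hΨab, hpΨ, mul_assoc,
    ← Finset.mul_sum, ← Finset.sum_div]
  ring
end

section
/- Let q and m be positive integers. For each i ∈ {1,…,m}, let Ψ_i be a real q×q matrix with nonnegative entries in which every column sums to 1 (a column-stochastic matrix), and let p_i be a probability vector on Fin q. Then every entry of the matrix product (I − p_1·𝟙ᵀ)Ψ_1 · (I − p_2·𝟙ᵀ)Ψ_2 ⋯ (I − p_m·𝟙ᵀ)Ψ_m has absolute value at most 1. -/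
open Matrix in
/-- A matrix of the form `S - r 𝟙ᵀ` with `S` column-stochastic and `r` a probability vector. -/
def IsCenteredStochastic {n : Type*} [Fintype n] [DecidableEq n] (M : Matrix n n ℝ) : Prop :=
  ∃ S ∈ colStochastic ℝ n, ∃ r ∈ stdSimplex ℝ n, M = S - vecMulVec r 1

section CenteredStochastic

open Matrix

variable {n : Type*} [Fintype n] [DecidableEq n] {M N S : Matrix n n ℝ} {r : n → ℝ}

theorem mulVec_mem_stdSimplex (hS : S ∈ colStochastic ℝ n) (hr : r ∈ stdSimplex ℝ n) :
    S *ᵥ r ∈ stdSimplex ℝ n :=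
  ⟨nonneg_mulVec_of_mem_colStochastic hS hr.1, (sum_mulVec_of_mem_colStochastic hS).trans hr.2⟩

theorem IsCenteredStochastic.one_sub_mul (hS : S ∈ colStochastic ℝ n)
    (hr : r ∈ stdSimplex ℝ n) : IsCenteredStochastic ((1 - vecMulVec r 1) * S) := by
  refine ⟨S, hS, r, hr, ?_⟩
  rw [Matrix.sub_mul, Matrix.one_mul, vecMulVec_mul, one_vecMul_of_mem_colStochastic hS]

theorem IsCenteredStochastic.one_vecMul (hM : IsCenteredStochastic M) :
    1 ᵥ* M = 0 := by
  obtain ⟨S, hS, r, hr, rfl⟩ := hM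
  rw [vecMul_sub, one_vecMul_of_mem_colStochastic hS, vecMul_vecMulVec, one_dotProduct, hr.2]
  simp

theorem IsCenteredStochastic.mul (hM : IsCenteredStochastic M)
    (hN : IsCenteredStochastic N) : IsCenteredStochastic (M * N) := by
  have hone := hN.one_vecMul
  obtain ⟨S, hS, r, -, rfl⟩ := hM
  obtain ⟨T, hT, s, hs, rfl⟩ := hN
  refine ⟨S * T, mul_mem hS hT, S *ᵥ s, mulVec_mem_stdSimplex hS hs, ?_⟩
  rw [Matrix.sub_mul, vecMulVec_mul, hone, vecMulVec_zero, sub_zero, Matrix.mul_sub,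
    mul_vecMulVec]

theorem IsCenteredStochastic.abs_apply_le_one (hM : IsCenteredStochastic M) (a b : n) :
    |M a b| ≤ 1 := by
  obtain ⟨S, hS, r, hr, rfl⟩ := hM
  have hS1 : S a b ≤ 1 := le_one_of_mem_colStochastic hS
  have hS0 : 0 ≤ S a b := nonneg_of_mem_colStochastic hS
  have hr1 : r a ≤ 1 :=
    hr.2 ▸ Finset.single_le_sum (fun i _ => hr.1 i) (Finset.mem_univ a)
  have hr0 := hr.1 a
  rw [Matrix.sub_apply, vecMulVec_apply, Pi.one_apply, mul_one, abs_le]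
  constructor <;> linarith

end CenteredStochastic

/-- Every entry of a product of centered column-stochastic ("projected stochastic")
matrices `(I − pᵢ𝟙ᵀ)Ψᵢ` is bounded in absolute value by 1 (the paper's claim on
matrix weights of self-avoiding paths). -/
theorem stmt8 (q m : ℕ) (hq : 0 < q) (hm : 0 < m)
    (Ψ : Fin m → Matrix (Fin q) (Fin q) ℝ)
    (hΨ0 : ∀ i a b, 0 ≤ Ψ i a b) (hΨ1 : ∀ i b, ∑ a, Ψ i a b = 1)
    (p : Fin m → Fin q → ℝ) (hp0 : ∀ i c, 0 ≤ p i c) (hp1 : ∀ i, ∑ c, p i c = 1) :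
    ∀ a b,
      |((List.ofFn fun i : Fin m =>
          ((1 - Matrix.of fun c _ => p i c) * Ψ i : Matrix (Fin q) (Fin q) ℝ)).prod
          : Matrix (Fin q) (Fin q) ℝ) a b| ≤ 1 := by
  refine IsCenteredStochastic.abs_apply_le_one ?_
  refine List.prod_induction_nonempty _ (fun _ _ => .mul) ?_ ?_
  · simpa [List.ofFn_eq_nil_iff] using hm.ne'
  · simp only [List.forall_mem_ofFn_iff]
    intro i
    have hp : (Matrix.of fun c _ => p i c : Matrix (Fin q) (Fin q) ℝ) =
        Matrix.vecMulVec (p i) 1 := by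
      ext
      simp [Matrix.vecMulVec_apply]
    rw [hp]
    exact .one_sub_mul (Matrix.mem_colStochastic_iff_sum.mpr ⟨hΨ0 i, hΨ1 i⟩) ⟨hp0 i, hp1 i⟩
end

section
/- Let G be a finite connected simple graph with v vertices and e edges. Suppose G has at most k vertices of degree exactly 1, and suppose e − v + 1 ≤ x for nonnegative integers k and x. Then ∑_{w : deg_G(w) ≥ 3} deg_G(w) ≤ 3·k + 12·x. -/
/-- For a finite connected graph with at most `k` leaves and excess
`e − v + 1 ≤ x`, the total degree of degree-≥3 vertices is at most `3k + 12x`. -/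
theorem stmt12 {V : Type*} [Fintype V] [DecidableEq V] (G : SimpleGraph V)
    [DecidableRel G.Adj] (hconn : G.Connected) (k x : ℕ)
    (hleaf : (Finset.univ.filter fun v => G.degree v = 1).card ≤ k)
    (hexc : G.edgeFinset.card + 1 ≤ x + Fintype.card V) :
    ∑ w ∈ Finset.univ.filter (fun w => 3 ≤ G.degree w), G.degree w ≤
      3 * k + 12 * x := by
  rcases subsingleton_or_nontrivial V with hV | hV
  · rw [Finset.sum_eq_zero]
    · exact Nat.zero_le _
    · intro w hw
      have hdeg := G.degree_lt_card_verts w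
      have hcard := Fintype.card_le_one_iff_subsingleton.mpr hV
      omega
  · have hpoint : ∀ v ∈ (Finset.univ : Finset V),
        (if 3 ≤ G.degree v then G.degree v else 0) + 6 ≤
          3 * G.degree v + 3 * (if G.degree v = 1 then 1 else 0) := by
      intro v _
      have hpos := hconn.preconnected.degree_pos_of_nontrivial v
      split_ifs <;> omega
    have hsum := Finset.sum_le_sum hpoint
    rw [Finset.sum_add_distrib, Finset.sum_add_distrib, ← Finset.mul_sum, ← Finset.mul_sum,
      G.sum_degrees_eq_twice_card_edges, ← Finset.sum_filter, ← Finset.card_filter,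
      Finset.sum_const, smul_eq_mul, Finset.card_univ] at hsum
    omega
end

section
/- Let r ≥ 1 be an integer and Γ a finite simple graph. Call a finite graph H an r-bicycle if H has at most r edges and Exc(H) ≥ 2 (equivalently, H contains at least two distinct cycles), and call H an r-bicycle frame if H is an r-bicycle and no proper subgraph of H is an r-bicycle. Suppose F is a set of e distinct edges of Γ such that every edge in F belongs to some subgraph of Γ that is an r-bicycle frame. Then Exc(Γ) ≥ e/r. -/
/-- The excess `|E| − |V| + c` of a subgraph `H` of an ambient graph. -/
noncomputable def subgraphExc {V : Type*} {G : SimpleGraph V} (H : G.Subgraph) : ℤ :=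
  (H.edgeSet.ncard : ℤ) - H.verts.ncard + Nat.card H.coe.ConnectedComponent

/-- `H` is an `r`-bicycle: it has at most `r` edges and excess at least `2`
(equivalently, at least two distinct cycles). -/
def IsBicycle {V : Type*} {G : SimpleGraph V} (r : ℕ) (H : G.Subgraph) : Prop :=
  H.edgeSet.ncard ≤ r ∧ 2 ≤ subgraphExc H

/-- `H` is an `r`-bicycle frame: an `r`-bicycle none of whose proper subgraphs is an
`r`-bicycle. -/
def IsBicycleFrame {V : Type*} {G : SimpleGraph V} (r : ℕ) (H : G.Subgraph) : Prop :=
  IsBicycle r H ∧ ∀ H' : G.Subgraph, H' ≤ H → H' ≠ H → ¬ IsBicycle r H'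

namespace SimpleGraph

variable {V : Type*} {G G' K : SimpleGraph V} {u v : V}

theorem Reachable.of_sup_edge {x y : V} (h : (G ⊔ edge u v).Reachable x y) :
    G.Reachable x y ∨ (G.Reachable x u ∧ G.Reachable v y) ∨
      (G.Reachable x v ∧ G.Reachable u y) := by
  obtain ⟨p⟩ := h
  induction p with
  | nil => exact .inl .rfl
  | cons h p ih =>
    simp only [sup_adj, edge_adj] at h
    rcases h with h | ⟨⟨rfl, rfl⟩ | ⟨rfl, rfl⟩, -⟩
    · rcases ih with ih | ⟨h₁, h₂⟩ | ⟨h₁, h₂⟩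
      · exact .inl (h.reachable.trans ih)
      · exact .inr (.inl ⟨h.reachable.trans h₁, h₂⟩)
      · exact .inr (.inr ⟨h.reachable.trans h₁, h₂⟩)
    · rcases ih with ih | ⟨h₁, h₂⟩ | ⟨h₁, h₂⟩
      · exact .inr (.inl ⟨.rfl, ih⟩)
      · exact .inr (.inl ⟨.rfl, h₂⟩)
      · exact .inl h₂
    · rcases ih with ih | ⟨h₁, h₂⟩ | ⟨h₁, h₂⟩
      · exact .inr (.inr ⟨.rfl, ih⟩)
      · exact .inl h₂
      · exact .inr (.inr ⟨.rfl, h₂⟩)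

theorem card_connectedComponent_le_sup_edge_add_one [Finite V] :
    Nat.card G.ConnectedComponent ≤ Nat.card (G ⊔ edge u v).ConnectedComponent + 1 := by
  classical
  rw [← Finite.card_option]
  refine Nat.card_le_card_of_injective
    (fun C => if C = G.connectedComponentMk v then none
      else some (C.map (Hom.ofLE (le_sup_left : G ≤ G ⊔ edge u v)))) fun C D h => ?_
  induction C using ConnectedComponent.ind with | _ x
  induction D using ConnectedComponent.ind with | _ y
  simp only [ConnectedComponent.eq, ConnectedComponent.map_mk, Hom.ofLE_apply] at h ⊢
  split_ifs at h with hx hy hy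
  · exact hx.trans hy.symm
  · rw [Option.some_inj, ConnectedComponent.eq] at h
    rcases h.of_sup_edge with h | ⟨-, h⟩ | ⟨h, -⟩
    · exact h
    · exact absurd h.symm hy
    · exact absurd h hx

theorem card_connectedComponent_le_sup_edge_of_reachable [Finite V] (h : G.Reachable u v) :
    Nat.card G.ConnectedComponent ≤ Nat.card (G ⊔ edge u v).ConnectedComponent := by
  refine Nat.card_le_card_of_injective
    (fun C => C.map (Hom.ofLE (le_sup_left : G ≤ G ⊔ edge u v))) fun C D hCD => ?_
  induction C using ConnectedComponent.ind with | _ x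
  induction D using ConnectedComponent.ind with | _ y
  simp only [ConnectedComponent.eq, ConnectedComponent.map_mk, Hom.ofLE_apply] at hCD ⊢
  rcases hCD.of_sup_edge with hxy | ⟨h₁, h₂⟩ | ⟨h₁, h₂⟩
  · exact hxy
  · exact h₁.trans (h.trans h₂)
  · exact h₁.trans (h.symm.trans h₂)

theorem card_connectedComponent_sup_edge_lt_of_not_reachable [Finite V]
    (h : ¬ G.Reachable u v) :
    Nat.card (G ⊔ edge u v).ConnectedComponent < Nat.card G.ConnectedComponent := by
  have hsurj := ConnectedComponent.surjective_map_ofLE (le_sup_left : G ≤ G ⊔ edge u v)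
  refine (Nat.card_le_card_of_surjective _ hsurj).lt_of_ne fun hcard => h ?_
  have hinj := ((Nat.bijective_iff_surjective_and_card _).2 ⟨hsurj, hcard.symm⟩).1
  refine ConnectedComponent.exact (hinj (ConnectedComponent.sound (Adj.reachable ?_)))
  have huv : u ≠ v := fun huv => h (huv ▸ .rfl)
  simp [edge_adj, huv]

theorem ncard_edgeSet_sup_edge [Finite V] (huv : u ≠ v) (h : ¬ G.Adj u v) :
    (G ⊔ edge u v).edgeSet.ncard = G.edgeSet.ncard + 1 := by
  rw [edgeSet_sup, edgeSet_edge_of_ne huv, Set.union_singleton,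
    Set.ncard_insert_of_notMem (by simpa using h)]

/-- The excess `|E| − |V| + c` of a graph. -/
noncomputable def excess (G : SimpleGraph V) : ℤ :=
  (G.edgeSet.ncard : ℤ) - Nat.card V + Nat.card G.ConnectedComponent

theorem excess_le_excess_sup_edge [Finite V] : G.excess ≤ (G ⊔ edge u v).excess := by
  by_cases huv : u = v
  · simp [huv]
  by_cases h : G.Adj u v
  · rw [sup_edge_of_adj _ h]
  have h₁ := ncard_edgeSet_sup_edge huv h
  have h₂ := card_connectedComponent_le_sup_edge_add_one (G := G) (u := u) (v := v)
  unfold excess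
  omega

theorem excess_lt_excess_sup_edge [Finite V] (huv : u ≠ v) (h : ¬ G.Adj u v)
    (hr : G.Reachable u v) : G.excess < (G ⊔ edge u v).excess := by
  have h₁ := ncard_edgeSet_sup_edge huv h
  have h₂ := card_connectedComponent_le_sup_edge_of_reachable hr
  unfold excess
  omega

theorem excess_sup_edge_le_of_not_reachable [Finite V] (hr : ¬ G.Reachable u v) :
    (G ⊔ edge u v).excess ≤ G.excess := by
  have h₁ := ncard_edgeSet_sup_edge (u := u) (v := v) (fun huv => hr (huv ▸ .rfl)) (fun h => hr h.reachable)
  have h₂ := card_connectedComponent_sup_edge_lt_of_not_reachable hr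
  unfold excess
  omega

theorem excess_le_excess_sup_fromEdgeSet [Finite V] (s : Finset (Sym2 V)) :
    G.excess ≤ (G ⊔ fromEdgeSet (s : Set (Sym2 V))).excess := by
  classical
  induction s using Finset.induction_on with
  | empty => simp
  | insert e s _ ih =>
    induction e with | _ x y
    rw [Finset.coe_insert, Set.insert_eq, fromEdgeSet_union, sup_comm (fromEdgeSet {s(x, y)}),
      ← sup_assoc]
    exact ih.trans excess_le_excess_sup_edge

theorem excess_mono [Finite V] : Monotone (excess : SimpleGraph V → ℤ) := fun G G' h => by
  have := excess_le_excess_sup_fromEdgeSet (G := G) G'.edgeSet.toFinite.toFinset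
  rwa [Set.Finite.coe_toFinset, fromEdgeSet_edgeSet, sup_eq_right.2 h] at this

theorem excess_bot [Finite V] : (⊥ : SimpleGraph V).excess = 0 := by
  have : Nat.card (⊥ : SimpleGraph V).ConnectedComponent = Nat.card V :=
    (Nat.card_eq_of_bijective (⊥ : SimpleGraph V).connectedComponentMk
      ⟨fun x y h => by simpa using h, Quot.mk_surjective⟩).symm
  simp [excess, this]

theorem excess_lt_excess_sup [Finite V] {e : Sym2 V} (heG : e ∉ G.edgeSet)
    (heK : e ∈ K.edgeSet) (hb : ¬ K.IsBridge e) : G.excess < (G ⊔ K).excess := by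
  induction e with | _ u v
  have huv : u ≠ v := heK.ne
  have hle : G ≤ (G ⊔ K).deleteEdges {s(u, v)} := fun x y h => by
    refine deleteEdges_adj.2 ⟨.inl h, fun hxy => heG ?_⟩
    rwa [← Set.mem_singleton_iff.1 hxy]
  have heq : (G ⊔ K).deleteEdges {s(u, v)} ⊔ edge u v = G ⊔ K := by
    ext x y
    have hK : s(x, y) = s(u, v) → K.Adj x y := fun h => by
      rw [← mem_edgeSet, h]; exact heK
    simp only [sup_adj, deleteEdges_adj, edge_adj, Set.mem_singleton_iff, ← Sym2.eq_iff] at hK ⊢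
    have := fun h : K.Adj x y => h.ne
    grind
  rw [← heq]
  refine (excess_mono hle).trans_lt (excess_lt_excess_sup_edge huv (by simp) ?_)
  rw [isBridge_iff, not_not] at hb
  exact hb.mono (deleteEdges_mono le_sup_right)

/-- If every edge of `F` lies on a cycle of a subgraph of `G` with at most `r` edges, then `F`
has at most `r * Exc(G)` edges. -/
theorem card_le_mul_excess [Finite V] {r : ℕ} (F : Finset (Sym2 V))
    (hF : ∀ e ∈ F, ∃ K ≤ G, K.edgeSet.ncard ≤ r ∧ e ∈ K.edgeSet ∧ ¬ K.IsBridge e) :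
    (F.card : ℤ) ≤ r * G.excess := by
  classical
  have key : ∃ M ≤ G, (F : Set (Sym2 V)) ⊆ M.edgeSet ∧
      (M.edgeSet.ncard : ℤ) ≤ r * M.excess := by
    induction F using Finset.induction_on with
    | empty => exact ⟨⊥, bot_le, by simp, by simp [excess_bot]⟩
    | insert e s _ ih =>
      obtain ⟨M, hMG, hsM, hM⟩ := ih fun e he => hF e (Finset.mem_insert_of_mem he)
      by_cases he : e ∈ M.edgeSet
      · exact ⟨M, hMG, by simp [Set.insert_subset_iff, he, hsM], hM⟩
      obtain ⟨K, hKG, hK, heK, hb⟩ := hF e (Finset.mem_insert_self e s)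
      refine ⟨M ⊔ K, sup_le hMG hKG, ?_, ?_⟩
      · rw [Finset.coe_insert, Set.insert_subset_iff, edgeSet_sup]
        exact ⟨.inr heK, hsM.trans Set.subset_union_left⟩
      · have h₁ := Set.ncard_union_le M.edgeSet K.edgeSet
        rw [← edgeSet_sup] at h₁
        have h₂ := excess_lt_excess_sup he heK hb
        calc ((M ⊔ K).edgeSet.ncard : ℤ) ≤ r * (M.excess + 1) := by push_cast [mul_add]; omega
          _ ≤ r * (M ⊔ K).excess := by gcongr; omega
  obtain ⟨M, hMG, hFM, hM⟩ := key
  have h := Set.ncard_le_ncard hFM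
  rw [Set.ncard_coe_finset] at h
  calc (F.card : ℤ) ≤ M.edgeSet.ncard := by exact_mod_cast h
    _ ≤ r * M.excess := hM
    _ ≤ r * G.excess := by gcongr; exact excess_mono hMG

theorem Subgraph.ncard_edgeSet_coe {H : G.Subgraph} :
    H.coe.edgeSet.ncard = H.edgeSet.ncard := by
  rw [← H.image_coe_edgeSet_coe]
  exact (Set.ncard_image_of_injective _ (Sym2.map.injective Subtype.val_injective)).symm

end SimpleGraph

open SimpleGraph

theorem subgraphExc_eq_excess_coe {V : Type*} {G : SimpleGraph V} (H : G.Subgraph) :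
    subgraphExc H = H.coe.excess := by
  rw [subgraphExc, excess, Subgraph.ncard_edgeSet_coe, Nat.card_coe_set_eq]

theorem IsBicycleFrame.not_isBridge {V : Type*} [Finite V] {G : SimpleGraph V} {r : ℕ}
    {H : G.Subgraph} (hH : IsBicycleFrame r H) {e : Sym2 V} (he : e ∈ H.edgeSet) :
    ¬ H.spanningCoe.IsBridge e := by
  intro hb
  induction e with | _ u v
  have huv : H.Adj u v := he
  set H' := H.deleteEdges {s(u, v)}
  have hle : H' ≤ H := H.deleteEdges_le _
  refine hH.2 H' hle (fun h => ?_) ⟨?_, ?_⟩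
  · have : H'.Adj u v := h ▸ huv
    simp [H'] at this
  · exact (Set.ncard_le_ncard (Subgraph.edgeSet_mono hle)).trans hH.1.1
  · refine hH.1.2.trans ?_
    rw [subgraphExc_eq_excess_coe, subgraphExc_eq_excess_coe]
    let a : H'.verts := ⟨u, H.edge_vert huv⟩
    let b : H'.verts := ⟨v, H.edge_vert huv.symm⟩
    have heq : H.coe = H'.coe ⊔ edge a b := by
      ext ⟨x, hx⟩ ⟨y, hy⟩
      have hK : s(x, y) = s(u, v) → H.Adj x y := fun h => by
        rw [← Subgraph.mem_edgeSet, h]; exact he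
      have := fun h : H.Adj x y => h.ne
      change H.Adj x y ↔ H'.Adj x y ∨ (edge a b).Adj ⟨x, hx⟩ ⟨y, hy⟩
      simp only [edge_adj, H', Subgraph.deleteEdges_adj, Set.mem_singleton_iff, a, b,
        Sym2.eq_iff, ne_eq] at hK ⊢
      grind
    rw [heq]
    refine excess_sup_edge_le_of_not_reachable fun hr => ?_
    rw [isBridge_iff] at hb
    refine hb ?_
    let f : H'.coe →g H.spanningCoe.deleteEdges {s(u, v)} :=
      ⟨Subtype.val, fun {x y} h => by simpa [H'] using h⟩
    exact hr.map f

/-- Friedman–Montanari lemma: if `e` distinct edges of `Γ` each belong to an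
`r`-bicycle frame, then `Exc(Γ) ≥ e/r`. -/
theorem stmt14 {V : Type*} [Fintype V] (Γ : SimpleGraph V) (r : ℕ) (hr : 1 ≤ r)
    (F : Finset (Sym2 V)) (hF : ↑F ⊆ Γ.edgeSet)
    (hframe : ∀ e ∈ F, ∃ H : Γ.Subgraph, IsBicycleFrame r H ∧ e ∈ H.edgeSet) :
    (F.card : ℝ) / r ≤
      (Γ.edgeSet.ncard : ℝ) - Fintype.card V + Nat.card Γ.ConnectedComponent := by
  have h := card_le_mul_excess (G := Γ) (r := r) F fun e he => by
    obtain ⟨H, hH, heH⟩ := hframe e he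
    exact ⟨H.spanningCoe, H.spanningCoe_le, by simpa using hH.1.1, by simpa using heH,
      hH.not_isBridge heH⟩
  rw [excess, Nat.card_eq_fintype_card] at h
  have hr' : (0 : ℝ) < r := by exact_mod_cast hr
  rw [div_le_iff₀' hr']
  exact_mod_cast h
end

section
/- For all positive integers v and L, the number of isomorphism classes of trees on v vertices having exactly L leaves is at most (4·L·v)^{2L+1}. -/
open Classical

/-- The setoid of graph-isomorphism on graphs on `Fin v` satisfying a property `P`. -/
def isoSetoid (v : ℕ) (P : SimpleGraph (Fin v) → Prop) :
    Setoid {G : SimpleGraph (Fin v) // P G} where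
  r G G' := Nonempty (G.val ≃g G'.val)
  iseqv := ⟨fun _ => ⟨SimpleGraph.Iso.refl⟩,
    fun h => h.elim fun e => ⟨e.symm⟩,
    fun h h' => h.elim fun e => h'.elim fun f => ⟨e.trans f⟩⟩

/-- The number of leaves (degree-1 vertices) of a graph on `Fin v`. -/
noncomputable def leafCount {v : ℕ} (G : SimpleGraph (Fin v)) : ℕ :=
  (Finset.univ.filter fun w => G.degree w = 1).card

namespace SimpleGraph

variable {V : Type*} {G : SimpleGraph V}

/-- The first `k` terms of `w` enumerate distinct vertices, each term after the first being adjacent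
to an earlier one, which is its immediate predecessor unless that predecessor is a leaf. -/
structure IsSearchOrder (G : SimpleGraph V) (w : ℕ → V) (k : ℕ) : Prop where
  injOn : Set.InjOn w (Set.Iio k)
  exists_adj : ∀ j, j + 1 < k →
    ∃ i ≤ j, G.Adj (w i) (w (j + 1)) ∧ (i = j ∨ ∃! y, G.Adj (w j) y)

namespace IsSearchOrder

variable {w : ℕ → V} {k : ℕ}

lemma exists_walk (h : G.IsSearchOrder w k) (i : ℕ) (hi : i < k) :
    ∃ p : G.Walk (w i) (w 0), ∀ x ∈ p.support, ∃ j ≤ i, x = w j := by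
  induction i using Nat.strong_induction_on with
  | _ i ih =>
    rcases i with _ | i
    · exact ⟨.nil, fun x hx => ⟨0, le_rfl, by simpa using hx⟩⟩
    · obtain ⟨j, hj, hadj, -⟩ := h.exists_adj i hi
      obtain ⟨p, hp⟩ := ih j (by omega) (by omega)
      refine ⟨.cons hadj.symm p, fun x hx => ?_⟩
      rw [Walk.support_cons, List.mem_cons] at hx
      rcases hx with rfl | hx
      · exact ⟨i + 1, le_rfl, rfl⟩
      · obtain ⟨l, hl, rfl⟩ := hp x hx
        exact ⟨l, by omega, rfl⟩

lemma eq_of_adj (h : G.IsSearchOrder w k) (hG : G.IsAcyclic) {i i' j : ℕ} (hj : j < k)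
    (hi : i < j) (hi' : i' < j) (ha : G.Adj (w i) (w j)) (ha' : G.Adj (w i') (w j)) : i = i' := by
  by_contra hne
  obtain ⟨p, hp⟩ := h.exists_walk i (hi.trans hj)
  obtain ⟨p', hp'⟩ := h.exists_walk i' (hi'.trans hj)
  have hw : w i ≠ w i' := fun e => hne (h.injOn (hi.trans hj) (hi'.trans hj) e)
  let q : G.Path (w i) (w i') := ⟨.cons ha (.cons ha'.symm .nil), by
    simp [Walk.cons_isPath_iff, ha.ne, ha'.ne', hw]⟩
  have hq := (hG.subsingleton_path _ _).elim (p.append p'.reverse).toPath q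
  have hmem : w j ∈ (p.append p'.reverse).support := by
    apply Walk.support_toPath_subset_support
    rw [hq]
    simp [q]
  rw [Walk.mem_support_append_iff, Walk.support_reverse, List.mem_reverse] at hmem
  obtain ⟨l, hl, e⟩ : ∃ l < j, w j = w l := by
    rcases hmem with hm | hm
    · obtain ⟨l, hl, e⟩ := hp _ hm
      exact ⟨l, by omega, e⟩
    · obtain ⟨l, hl, e⟩ := hp' _ hm
      exact ⟨l, by omega, e⟩
  have := h.injOn hj (hl.trans hj) e
  omega

lemma update (h : G.IsSearchOrder w (k + 1)) {y : V} (hy : ∀ i ≤ k, w i ≠ y)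
    (hadj : ∃ i ≤ k, G.Adj (w i) y ∧ (i = k ∨ ∃! z, G.Adj (w k) z)) :
    G.IsSearchOrder (Function.update w (k + 1) y) (k + 2) := by
  have hlt : ∀ i ≤ k, Function.update w (k + 1) y i = w i := fun i hi =>
    Function.update_of_ne (by omega) _ _
  have heq : Function.update w (k + 1) y (k + 1) = y := Function.update_self _ _ _
  constructor
  · intro a ha b hb e
    simp only [Set.mem_Iio] at ha hb
    rcases Nat.lt_succ_iff_lt_or_eq.1 ha with ha | rfl <;>
      rcases Nat.lt_succ_iff_lt_or_eq.1 hb with hb | rfl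
    · rw [hlt a (by omega), hlt b (by omega)] at e
      exact h.injOn ha hb e
    · rw [hlt a (by omega), heq] at e
      exact (hy a (by omega) e).elim
    · rw [hlt b (by omega), heq] at e
      exact (hy b (by omega) e.symm).elim
    · rfl
  · intro j hj
    rcases Nat.lt_succ_iff_lt_or_eq.1 hj with hj | hj
    · obtain ⟨i, hi, hij⟩ := h.exists_adj j hj
      exact ⟨i, hi, by rwa [hlt i (by omega), hlt j (by omega), hlt (j + 1) (by omega)]⟩
    · obtain rfl : j = k := by omega
      obtain ⟨i, hi, hij⟩ := hadj
      exact ⟨i, hi, by rwa [hlt i hi, hlt j le_rfl, heq]⟩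

end IsSearchOrder

lemma IsTree.exists_isSearchOrder [Fintype V] (hG : G.IsTree) (k : ℕ) (hk : k < Fintype.card V) :
    ∃ w, G.IsSearchOrder w (k + 1) := by
  induction k with
  | zero =>
    obtain ⟨x⟩ := hG.connected.nonempty
    exact ⟨fun _ => x, fun a ha b hb _ => by simp at ha hb; omega, fun j hj => by omega⟩
  | succ k ih =>
    obtain ⟨w, h⟩ := ih (by omega)
    by_cases hex : ∃ y, G.Adj (w k) y ∧ ∀ i ≤ k, w i ≠ y
    · obtain ⟨y, hadj, hy⟩ := hex
      exact ⟨_, h.update hy ⟨k, le_rfl, hadj, .inl rfl⟩⟩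
    · push Not at hex
      have hleaf : ∃! z, G.Adj (w k) z := by
        have : Nontrivial V := Fintype.one_lt_card_iff_nontrivial.1 (by omega)
        obtain ⟨z, hz⟩ := hG.connected.preconnected.exists_adj_of_nontrivial (w k)
        refine ⟨z, hz, fun z' hz' => ?_⟩
        obtain ⟨i, hi, rfl⟩ := hex z hz
        obtain ⟨i', hi', rfl⟩ := hex z' hz'
        have hik : i ≠ k := by rintro rfl; exact hz.ne rfl
        have hik' : i' ≠ k := by rintro rfl; exact hz'.ne rfl
        rw [h.eq_of_adj hG.isAcyclic (Nat.lt_succ_self k) (by omega) (by omega) hz.symm hz'.symm]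
      obtain ⟨x, hx⟩ : ∃ x, x ∉ (Finset.range (k + 1)).image w := by
        by_contra! hall
        have := Finset.card_le_card (fun x _ => hall x : Finset.univ ⊆ _)
        have := Finset.card_image_le (s := Finset.range (k + 1)) (f := w)
        simp only [Finset.card_univ, Finset.card_range] at *
        omega
      obtain ⟨p⟩ := hG.connected.preconnected (w 0) x
      obtain ⟨d, -, hd, hd'⟩ := p.exists_boundary_dart (w '' Set.Iic k) ⟨0, by simp, rfl⟩
        (by rintro ⟨i, hi, rfl⟩
            exact hx (Finset.mem_image_of_mem _ (by simp at *; omega)))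
      obtain ⟨i, hi, hiw⟩ := hd
      refine ⟨_, h.update (y := d.snd) (fun i hi e => hd' ⟨i, hi, e⟩) ⟨i, hi, ?_, .inr hleaf⟩⟩
      rw [hiw]
      exact d.adj

/-- The graph in which the predecessor of `j` is the `i` with `(j, i)` in the range of `c`, or
`j - 1` if there is no such pair. -/
def ofParentCode {ι : Type*} {v : ℕ} (c : ι → Fin v × Fin v) : SimpleGraph (Fin v) :=
  fromRel fun i j => (∃ t, c t = (j, i)) ∨ ((j : ℕ) = i + 1 ∧ ∀ t, (c t).1 ≠ j)

lemma IsTree.exists_iso_ofParentCode {v : ℕ} {G : SimpleGraph (Fin v)} (hG : G.IsTree) {ι : Type*}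
    (e : ι ≃ {x // ∃! y, G.Adj x y}) :
    ∃ c : ι → Fin v × Fin v, Nonempty (ofParentCode c ≃g G) := by
  have hv : 0 < v := by
    obtain ⟨x⟩ := hG.connected.nonempty
    exact x.pos
  obtain ⟨w, h⟩ := hG.exists_isSearchOrder (v - 1) (by simpa using hv)
  rw [Nat.sub_add_cancel hv] at h
  have hinj : Function.Injective fun i : Fin v => w i := fun a b hab =>
    Fin.ext (h.injOn a.2 b.2 hab)
  let σ : Fin v ≃ Fin v := Equiv.ofBijective _ (Finite.injective_iff_bijective.1 hinj)
  have hσ : ∀ i, σ i = w i := fun _ => rfl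
  choose! p hp hpadj hpleaf using h.exists_adj
  let c : ι → Fin v × Fin v := fun t =>
    if ht : (σ.symm (e t) : ℕ) + 1 < v then
      (⟨_, ht⟩, ⟨p (σ.symm (e t)), by have := hp _ ht; omega⟩)
    else (⟨0, hv⟩, ⟨0, hv⟩)
  have hc : ∀ t (i j : Fin v), i ≠ j → c t = (j, i) →
      (j : ℕ) = σ.symm (e t) + 1 ∧ (i : ℕ) = p (σ.symm (e t)) := by
    intro t i j hij hct
    simp only [c] at hct
    split_ifs at hct with ht
    · simp only [Prod.mk.injEq, Fin.ext_iff] at hct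
      exact ⟨hct.1.symm, hct.2.symm⟩
    · simp only [Prod.mk.injEq] at hct
      exact (hij (hct.2.symm.trans hct.1)).elim
  have key : ∀ i j : Fin v, i < j → (G.Adj (σ i) (σ j) ↔
      (∃ t, c t = (j, i)) ∨ ((j : ℕ) = i + 1 ∧ ∀ t, (c t).1 ≠ j)) := by
    intro i j hij
    obtain ⟨m, hm⟩ : ∃ m, (j : ℕ) = m + 1 := Nat.exists_eq_succ_of_ne_zero (by omega)
    have hmv : m + 1 < v := hm ▸ j.2
    have hadj : G.Adj (σ i) (σ j) ↔ (i : ℕ) = p m := by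
      rw [hσ, hσ, hm]
      refine ⟨fun ha => ?_, fun ha => ha ▸ hpadj m hmv⟩
      exact h.eq_of_adj hG.isAcyclic hmv (by omega) (by have := hp m hmv; omega) ha (hpadj m hmv)
    rw [hadj]
    constructor
    · intro hi
      by_cases hl : ∃! y, G.Adj (σ ⟨m, by omega⟩) y
      · refine .inl ⟨e.symm ⟨_, hl⟩, ?_⟩
        simp [c, hmv, Prod.ext_iff, Fin.ext_iff, hi, hm]
      · have hpm := (hpleaf m hmv).resolve_right hl
        refine .inr ⟨by omega, fun t ht => hl ?_⟩
        have hct := hc t (c t).2 j (fun e' => ?_) (Prod.ext ht rfl)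
        · have : σ.symm (e t) = ⟨m, by omega⟩ := Fin.ext (by simp; omega)
          rw [← this, Equiv.apply_symm_apply]
          exact (e t).2
        · have hct : c t = (j, j) := Prod.ext ht e'
          simp only [c] at hct
          split_ifs at hct with ht'
          · have := hp _ ht'
            simp only [Prod.mk.injEq, Fin.ext_iff] at hct
            omega
          · simp only [Prod.mk.injEq, Fin.ext_iff] at hct
            omega
    · rintro (⟨t, ht⟩ | ⟨hji, ht⟩)
      · obtain ⟨h1, h2⟩ := hc t i j hij.ne ht
        rw [h2]
        congr 1
        omega
      · rcases hpleaf m hmv with hpm | hl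
        · omega
        · refine (ht (e.symm ⟨σ ⟨m, by omega⟩, hl⟩) ?_).elim
          simp [c, hmv, Fin.ext_iff, hm]
  have hno : ∀ i j : Fin v, i < j →
      ¬ ((∃ t, c t = (i, j)) ∨ ((i : ℕ) = j + 1 ∧ ∀ t, (c t).1 ≠ i)) := by
    rintro i j hij (⟨t, ht⟩ | ⟨hji, -⟩)
    · obtain ⟨h1, h2⟩ := hc t j i hij.ne' ht
      have := hp (σ.symm (e t)) (by omega)
      omega
    · omega
  refine ⟨c, ⟨σ, ?_⟩⟩
  intro i j
  simp only [ofParentCode, fromRel_adj]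
  rcases lt_trichotomy i j with hij | rfl | hij
  · rw [key i j hij, or_iff_left (hno i j hij), and_iff_right hij.ne]
  · simp
  · rw [G.adj_comm, key j i hij, or_iff_right (hno j i hij), and_iff_right hij.ne']

end SimpleGraph

/-- BMR19, Lemma 6.33: the number of isomorphism classes of trees on `v` vertices with
exactly `L` leaves is at most `(4·L·v)^(2L+1)`. -/
theorem stmt15 (v L : ℕ) (hv : 0 < v) (hL : 0 < L) :
    Nat.card (Quotient (isoSetoid v fun G => G.IsTree ∧ leafCount G = L)) ≤
      (4 * L * v) ^ (2 * L + 1) := by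
  have hcode : ∀ q : Quotient (isoSetoid v fun G => G.IsTree ∧ leafCount G = L),
      ∃ c : Fin L → Fin v × Fin v, ∃ G, q = Quotient.mk _ G ∧
        Nonempty (SimpleGraph.ofParentCode c ≃g G.val) := by
    intro q
    induction q using Quotient.inductionOn with
    | _ G =>
      have hcard : Fintype.card {x // ∃! y, G.val.Adj x y} = L := by
        refine Eq.trans ?_ G.2.2
        rw [Fintype.card_subtype, leafCount]
        simp only [SimpleGraph.degree_eq_one_iff_existsUnique_adj]
      obtain ⟨c, hc⟩ := G.2.1.exists_iso_ofParentCode (Fintype.equivFinOfCardEq hcard).symm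
      exact ⟨c, G, rfl, hc⟩
  choose code rep hrep hiso using hcode
  have hinj : Function.Injective code := by
    intro q q' hqq
    rw [hrep q, hrep q']
    obtain ⟨f⟩ := hiso q
    obtain ⟨g⟩ := hiso q'
    rw [hqq] at f
    exact Quotient.sound ⟨f.symm.trans g⟩
  calc Nat.card (Quotient (isoSetoid v fun G => G.IsTree ∧ leafCount G = L))
      ≤ Nat.card (Fin L → Fin v × Fin v) := Nat.card_le_card_of_injective code hinj
    _ = v ^ (2 * L) := by simp [pow_mul, pow_two]
    _ ≤ (4 * L * v) ^ (2 * L) := Nat.pow_le_pow_left (Nat.le_mul_of_pos_left v (by positivity)) _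
    _ ≤ (4 * L * v) ^ (2 * L + 1) := Nat.pow_le_pow_right (by positivity) (Nat.le_succ _)
end
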